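/- Let k be a field, and let P = k[y_1,…,y_m, z_1,…,z_s] be a polynomial ring. Let R be a commutative ring with a surjective k-algebra homomorphism w : P → R, and let 𝔠 ⊂ R be the ideal generated by w(z_1),…,w(z_s). Let D = H^s_{(z_1,…,z_s)}(P) be the s-th local cohomology module of P with support in the ideal (z_1,…,z_s) (the module of inverse polynomials, isomorphic to k[y_1,…,y_m] ⊗ z_1^{-1}⋯z_s^{-1} k[z_1^{-1},…,z_s^{-1}]). Then for every i there is an isomorphism of k-vector spaces H^i_𝔠(R) ≅ Tor^P_{s−i}(R, D), where R is regarded as a P-module via w and Tor_j = 0 for j < 0. -/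

import Mathlib

open CategoryTheory MvPolynomial

section Stmt8

variable (k : Type) [Field k] (m s : ℕ) (R : Type) [CommRing R] [Algebra k R]
  (w : MvPolynomial (Fin m ⊕ Fin s) k →ₐ[k] R)

/-- `D = H^s_{(z_1,…,z_s)}(P)`, the `s`-th local cohomology of `P = k[y_1,…,y_m,z_1,…,z_s]`
with support in the ideal generated by the `z`-variables (the module of inverse
polynomials). -/
noncomputable def invPolyModule : ModuleCat (MvPolynomial (Fin m ⊕ Fin s) k) :=
  (localCohomology
      (Ideal.span
        (Set.range fun t : Fin s => (X (Sum.inr t) : MvPolynomial (Fin m ⊕ Fin s) k))) s).obj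
    (ModuleCat.of _ (MvPolynomial (Fin m ⊕ Fin s) k))

/-- `R`, regarded as a `P`-module via the surjection `w : P → R`. -/
noncomputable def rAsPModule : ModuleCat (MvPolynomial (Fin m ⊕ Fin s) k) :=
  letI : Module (MvPolynomial (Fin m ⊕ Fin s) k) R := Module.compHom R w.toRingHom
  ModuleCat.of _ R

/-- `Tor^P_j(R, D)`. -/
noncomputable def torRD (j : ℕ) : ModuleCat (MvPolynomial (Fin m ⊕ Fin s) k) :=
  ((Tor (ModuleCat (MvPolynomial (Fin m ⊕ Fin s) k)) j).obj (rAsPModule k m s R w)).obj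
    (invPolyModule k m s)

/-- `H^i_𝔠(R)`, where `𝔠 ⊆ R` is the ideal generated by `w(z_1),…,w(z_s)`. -/
noncomputable def locCohR (i : ℕ) : ModuleCat R :=
  (localCohomology (Ideal.span (Set.range fun t : Fin s => w (X (Sum.inr t)))) i).obj
    (ModuleCat.of R R)

end Stmt8

section ExtComparison

open Abelian

universe w v u t

variable {R : Type t} [CommRing R] {C : Type u} [Category.{v} C] [Abelian C] [Linear R C]

namespace CategoryTheory.ProjectiveResolution

variable {X X' : C} (K : ProjectiveResolution X) (K' : ProjectiveResolution X') (Y : C)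

variable (R) in
/-- The complex `Hom(K, Y)`, in the opposite of the category of modules. -/
noncomputable abbrev homComplexOp : ChainComplex (ModuleCat.{v} R)ᵒᵖ ℕ :=
  (((linearYoneda R C).obj Y).rightOp.mapHomologicalComplex _).obj K.complex

variable (R) in
/-- The morphism underlying a cocycle of `Hom(K, Y)`. -/
noncomputable def cocycleHom (n : ℕ) :
    ((K.homComplexOp R Y).opcycles n).unop →ₗ[R] (K.complex.X n ⟶ Y) :=
  ((K.homComplexOp R Y).pOpcycles n).unop.hom

lemma cocycleHom_injective (n : ℕ) : Function.Injective (K.cocycleHom R Y n) :=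
  (ModuleCat.mono_iff_injective ((K.homComplexOp R Y).pOpcycles n).unop).1 inferInstance

lemma d_comp_cocycleHom (n : ℕ) (x : ((K.homComplexOp R Y).opcycles n).unop) :
    K.complex.d (n + 1) n ≫ K.cocycleHom R Y n x = 0 := by
  have := (K.homComplexOp R Y).d_pOpcycles (n + 1) n
  have := congr_arg Quiver.Hom.unop this
  exact ConcreteCategory.congr_hom this x

lemma exists_cocycleHom_eq (n : ℕ) (f : K.complex.X n ⟶ Y) (hf : K.complex.d (n + 1) n ≫ f = 0) :
    ∃ x, K.cocycleHom R Y n x = f := by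
  have h := (ShortComplex.exact_of_g_is_cokernel
    (ShortComplex.mk _ _ ((K.homComplexOp R Y).d_pOpcycles (n + 1) n))
    ((K.homComplexOp R Y).opcyclesIsCokernel (n + 1) n (by simp))).unop
  rw [ShortComplex.moduleCat_exact_iff] at h
  exact h f hf

variable (R) in
/-- The map sending a cocycle of `Hom(K, Y)` to its cohomology class. -/
noncomputable def cocycleToHomology (n : ℕ) :
    ((K.homComplexOp R Y).opcycles n).unop →ₗ[R] ((K.homComplexOp R Y).homology n).unop :=
  ((K.homComplexOp R Y).homologyι n).unop.hom

lemma cocycleToHomology_surjective (n : ℕ) :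
    Function.Surjective (K.cocycleToHomology R Y n) :=
  (ModuleCat.epi_iff_surjective ((K.homComplexOp R Y).homologyι n).unop).1 inferInstance

variable [HasExt.{w} C]

lemma extMk_zero_eq_zero_iff {Y : C} (f : K.complex.X 0 ⟶ Y) (hf : K.complex.d 1 0 ≫ f = 0) :
    K.extMk f 1 rfl hf = 0 ↔ f = 0 := by
  simp only [← K.extEquivCohomologyClass.apply_eq_iff_eq,
    extEquivCohomologyClass_extMk, extEquivCohomologyClass_zero,
    CochainComplex.HomComplex.CohomologyClass.mk_eq_zero_iff]
  rw [CochainComplex.HomComplex.Cocycle.toSingleMk_mem_coboundaries_iff _ _ _ _ _ 1 (by simp)]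
  constructor
  · rintro ⟨g, hg⟩
    have h0 : K.cochainComplex.d (-(0 : ℕ)) 1 = 0 :=
      (K.cochainComplex.isZero_of_isStrictlyLE 0 1).eq_of_tgt _ _
    rw [h0, Limits.zero_comp] at hg
    rw [← cancel_epi (K.cochainComplexXIso (-(0 : ℕ)) 0 rfl).hom, ← hg, Limits.comp_zero]
  · rintro rfl
    exact ⟨0, by simp⟩

lemma smul_extMk {Y : C} {n : ℕ} (r : R) (f : K.complex.X n ⟶ Y) (m : ℕ) (hm : n + 1 = m)
    (hf : K.complex.d m n ≫ f = 0) :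
    r • K.extMk f m hm hf = K.extMk (r • f) m hm (by simp [hf]) := by
  rw [Ext.smul_eq_comp_mk₀, extMk_comp_mk₀]
  simp

variable (R) in
/-- The map sending a cocycle of `Hom(K, Y)` to its class in `Ext`. -/
noncomputable def cocycleToExt (n : ℕ) :
    ((K.homComplexOp R Y).opcycles n).unop →ₗ[R] Ext X Y n where
  toFun x := K.extMk (K.cocycleHom R Y n x) (n + 1) rfl (K.d_comp_cocycleHom Y n x)
  map_add' x y := by rw [add_extMk]; simp only [map_add]
  map_smul' r x := by rw [RingHom.id_apply, smul_extMk]; simp only [map_smul]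

lemma cocycleToExt_surjective (n : ℕ) : Function.Surjective (K.cocycleToExt R Y n) := by
  intro α
  obtain ⟨f, hf, rfl⟩ := K.extMk_surjective α (n + 1) rfl
  obtain ⟨x, rfl⟩ := K.exists_cocycleHom_eq (R := R) Y n f hf
  exact ⟨x, rfl⟩

lemma ker_cocycleToHomology (n : ℕ) :
    LinearMap.ker (K.cocycleToHomology R Y n) = LinearMap.ker (K.cocycleToExt R Y n) := by
  ext x
  have h := (ShortComplex.exact_of_f_is_kernel
    (ShortComplex.mk _ _ ((K.homComplexOp R Y).homologyι_comp_fromOpcycles n (n - 1)))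
    ((K.homComplexOp R Y).homologyIsKernel n (n - 1) (by cases n <;> simp))).unop
  rw [ShortComplex.moduleCat_exact_iff] at h
  rw [LinearMap.mem_ker, LinearMap.mem_ker]
  have hd : ∀ y : K.complex.X (n - 1) ⟶ Y,
      K.cocycleHom R Y n (((K.homComplexOp R Y).fromOpcycles n (n - 1)).unop.hom y) =
        K.complex.d n (n - 1) ≫ y := fun y =>
    ConcreteCategory.congr_hom
      (congr_arg Quiver.Hom.unop ((K.homComplexOp R Y).p_fromOpcycles n (n - 1))) y
  have h1 : K.cocycleToHomology R Y n x = 0 ↔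
      ∃ y : K.complex.X (n - 1) ⟶ Y, K.complex.d n (n - 1) ≫ y = K.cocycleHom R Y n x := by
    constructor
    · intro hx
      obtain ⟨y, hy⟩ := h x hx
      exact ⟨y, (hd y).symm.trans (congr_arg (K.cocycleHom R Y n) hy)⟩
    · rintro ⟨y, hy⟩
      rw [← hd] at hy
      rw [← K.cocycleHom_injective Y n hy]
      exact ConcreteCategory.congr_hom (congr_arg Quiver.Hom.unop
        ((K.homComplexOp R Y).homologyι_comp_fromOpcycles n (n - 1))) y
  rw [h1]
  change _ ↔ K.extMk (K.cocycleHom R Y n x) (n + 1) rfl (K.d_comp_cocycleHom Y n x) = 0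
  cases n with
  | zero =>
    rw [extMk_zero_eq_zero_iff]
    constructor
    · rintro ⟨y, hy⟩
      rw [← hy, K.complex.shape _ _ (by simp), Limits.zero_comp]
    · intro hx
      exact ⟨0, by simp [hx]⟩
  | succ n => exact (extMk_eq_zero_iff _ _ _ _ _ n rfl).symm

variable (R) in
/-- The cohomology of `Hom(K, Y)` identifies to `Ext`. -/
noncomputable def homologyLinearEquivExt (n : ℕ) :
    ((K.homComplexOp R Y).homology n).unop ≃ₗ[R] Ext X Y n :=
  ((K.cocycleToHomology R Y n).quotKerEquivOfSurjective
      (K.cocycleToHomology_surjective Y n)).symm.trans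
    ((Submodule.quotEquivOfEq _ _ (K.ker_cocycleToHomology Y n)).trans
      ((K.cocycleToExt R Y n).quotKerEquivOfSurjective (K.cocycleToExt_surjective Y n)))

lemma homologyLinearEquivExt_cocycleToHomology (n : ℕ)
    (x : ((K.homComplexOp R Y).opcycles n).unop) :
    K.homologyLinearEquivExt R Y n (K.cocycleToHomology R Y n x) = K.cocycleToExt R Y n x := by
  have : ((K.cocycleToHomology R Y n).quotKerEquivOfSurjective
      (K.cocycleToHomology_surjective Y n)).symm (K.cocycleToHomology R Y n x) =
      Submodule.Quotient.mk x := by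
    rw [LinearEquiv.symm_apply_eq]
    rfl
  simp only [homologyLinearEquivExt, LinearEquiv.trans_apply, this]
  rfl

variable {K K'} in
lemma mk₀_comp_homologyLinearEquivExt (n : ℕ) {g : X' ⟶ X} (φ : Hom K' K g)
    (x : ((K.homComplexOp R Y).homology n).unop) :
    (Ext.mk₀ g).comp (K.homologyLinearEquivExt R Y n x) (zero_add _) =
      K'.homologyLinearEquivExt R Y n ((HomologicalComplex.homologyMap
        ((((linearYoneda R C).obj Y).rightOp.mapHomologicalComplex _).map φ.hom) n).unop.hom x) := by
  obtain ⟨c, rfl⟩ := K.cocycleToHomology_surjective Y n x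
  set ψ := (((linearYoneda R C).obj Y).rightOp.mapHomologicalComplex (ComplexShape.down ℕ)).map
    φ.hom
  have h1 : (HomologicalComplex.homologyMap ψ n).unop.hom (K.cocycleToHomology R Y n c) =
      K'.cocycleToHomology R Y n ((HomologicalComplex.opcyclesMap ψ n).unop.hom c) :=
    ConcreteCategory.congr_hom
      (congr_arg Quiver.Hom.unop (HomologicalComplex.homologyι_naturality ψ n).symm).symm c
  have h2 : K'.cocycleHom R Y n ((HomologicalComplex.opcyclesMap ψ n).unop.hom c) =
      φ.hom.f n ≫ K.cocycleHom R Y n c :=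
    ConcreteCategory.congr_hom
      (congr_arg Quiver.Hom.unop (HomologicalComplex.p_opcyclesMap ψ n)) c
  rw [h1, homologyLinearEquivExt_cocycleToHomology, homologyLinearEquivExt_cocycleToHomology]
  change (Ext.mk₀ g).comp
      (K.extMk (K.cocycleHom R Y n c) (n + 1) rfl (K.d_comp_cocycleHom Y n c)) _ =
    K'.extMk (K'.cocycleHom R Y n ((HomologicalComplex.opcyclesMap ψ n).unop.hom c)) (n + 1) rfl
      (K'.d_comp_cocycleHom Y n _)
  rw [mk₀_comp_extMk _ _ _ _ φ]
  congr 1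
  exact h2.symm

end CategoryTheory.ProjectiveResolution

namespace CategoryTheory

variable [HasExt.{w} C] [EnoughProjectives C]

variable (R) in
/-- The `Ext`-modules defined as derived functors identify to the `Ext`-modules defined in
the derived category. -/
noncomputable def extLinearEquiv (X Y : C) (n : ℕ) :
    ((_root_.Ext R C n).obj (Opposite.op X)).obj Y ≃ₗ[R] Abelian.Ext X Y n :=
  ((projectiveResolution X).isoLeftDerivedObj
      ((linearYoneda R C).obj Y).rightOp n).unop.symm.toLinearEquiv.trans
    ((projectiveResolution X).homologyLinearEquivExt R Y n)

lemma extLinearEquiv_apply (X Y : C) (n : ℕ)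
    (x : ((_root_.Ext R C n).obj (Opposite.op X)).obj Y) :
    extLinearEquiv R X Y n x = (projectiveResolution X).homologyLinearEquivExt R Y n
      (((projectiveResolution X).isoLeftDerivedObj
        ((linearYoneda R C).obj Y).rightOp n).inv.unop.hom x) := by
  simp only [extLinearEquiv]
  rfl

lemma extLinearEquiv_map {X X' : C} (g : X' ⟶ X) (Y : C) (n : ℕ)
    (x : ((_root_.Ext R C n).obj (Opposite.op X)).obj Y) :
    extLinearEquiv R X' Y n (((_root_.Ext R C n).map g.op).app Y x) =
      (Ext.mk₀ g).comp (extLinearEquiv R X Y n x) (zero_add _) := by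
  let φ : ProjectiveResolution.Hom (projectiveResolution X') (projectiveResolution X) g :=
    { hom := ProjectiveResolution.lift g _ _
      hom_f_zero_comp_π_f_zero :=
        HomologicalComplex.congr_hom (ProjectiveResolution.lift_commutes g _ _) 0 }
  have h := ProjectiveResolution.isoLeftDerivedObj_inv_naturality g (projectiveResolution X')
    (projectiveResolution X) φ.hom (ProjectiveResolution.lift_commutes_zero g _ _)
    ((linearYoneda R C).obj Y).rightOp n
  have h' := ConcreteCategory.congr_hom (congr_arg Quiver.Hom.unop h) x
  rw [extLinearEquiv_apply, extLinearEquiv_apply]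
  refine Eq.trans ?_ (ProjectiveResolution.mk₀_comp_homologyLinearEquivExt Y n φ
    (((projectiveResolution X).isoLeftDerivedObj
      ((linearYoneda R C).obj Y).rightOp n).inv.unop.hom x)).symm
  exact congr_arg ((projectiveResolution X').homologyLinearEquivExt R Y n) h'

end CategoryTheory

end ExtComparison

section ExtColim

open Abelian Opposite

universe u

variable {A : Type u} [CommRing A]

/-- The transition maps between the modules `Ext (X n) M i`, for an inverse system `X`. -/
noncomputable abbrev extTransition (X : ℕᵒᵖ ⥤ ModuleCat.{u} A) (i : ℕ) (M : ModuleCat.{u} A)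
    (n n' : ℕ) (h : n ≤ n') : Ext (X.obj (op n)) M i →ₗ[A] Ext (X.obj (op n')) M i :=
  Ext.precompOfLinear (Ext.mk₀ (X.map (homOfLE h).op)) A M (zero_add i)

instance (X : ℕᵒᵖ ⥤ ModuleCat.{u} A) (i : ℕ) (M : ModuleCat.{u} A) :
    DirectedSystem (fun n => Ext (X.obj (op n)) M i) (extTransition X i M · · ·) where
  map_self n x := by
    rw [Ext.bilinearCompOfLinear_apply_apply]
    convert! Ext.mk₀_id_comp x
    exact X.map_id _
  map_map n₁ n₂ n₃ h₁ h₂ x := by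
    simp only [Ext.bilinearCompOfLinear_apply_apply, Ext.mk₀_comp_mk₀_assoc]
    rw [← X.map_comp]
    rfl

/-- The colimit of the modules `Ext (X n) M i`, for an inverse system `X`. -/
noncomputable def ExtColim (X : ℕᵒᵖ ⥤ ModuleCat.{u} A) (i : ℕ) (M : ModuleCat.{u} A) : Type u :=
  Module.DirectLimit (fun n => Ext (X.obj (op n)) M i) (extTransition X i M)

namespace ExtColim

variable (X : ℕᵒᵖ ⥤ ModuleCat.{u} A)

noncomputable instance (i : ℕ) (M : ModuleCat.{u} A) : AddCommGroup (ExtColim X i M) :=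
  inferInstanceAs (AddCommGroup (Module.DirectLimit _ (extTransition X i M)))

noncomputable instance (i : ℕ) (M : ModuleCat.{u} A) : Module A (ExtColim X i M) :=
  inferInstanceAs (Module A (Module.DirectLimit _ (extTransition X i M)))

variable {X}

/-- The canonical maps to the colimit. -/
noncomputable def of {i : ℕ} {M : ModuleCat.{u} A} (n : ℕ) :
    Ext (X.obj (op n)) M i →ₗ[A] ExtColim X i M :=
  Module.DirectLimit.of A ℕ _ (extTransition X i M) n

lemma of_mk₀_comp {i : ℕ} {M : ModuleCat.{u} A} {n n' : ℕ} (h : n ≤ n')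
    (x : Ext (X.obj (op n)) M i) :
    of n' ((Ext.mk₀ (X.map (homOfLE h).op)).comp x (zero_add i)) = of n x :=
  Module.DirectLimit.of_f (f := extTransition X i M) (hij := h)

lemma exists_of {i : ℕ} {M : ModuleCat.{u} A} (x : ExtColim X i M) : ∃ n y, of n y = x :=
  Module.DirectLimit.exists_of x

lemma exists_of₂ {i : ℕ} {M : ModuleCat.{u} A} (x x' : ExtColim X i M) :
    ∃ n y y', of n y = x ∧ of n y' = x' :=
  Module.DirectLimit.exists_of₂ x x'

lemma of_eq_zero_iff {i : ℕ} {M : ModuleCat.{u} A} {n : ℕ} (x : Ext (X.obj (op n)) M i) :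
    of n x = 0 ↔
      ∃ n', ∃ h : n ≤ n', (Ext.mk₀ (X.map (homOfLE h).op)).comp x (zero_add i) = 0 := by
  constructor
  · intro h
    exact Module.DirectLimit.of.zero_exact (f := extTransition X i M) h
  · rintro ⟨n', h, hx⟩
    rw [← of_mk₀_comp h, hx, map_zero]

lemma hom_ext {i : ℕ} {M : ModuleCat.{u} A} {N : Type*} [AddCommGroup N] [Module A N]
    {f g : ExtColim X i M →ₗ[A] N} (h : ∀ n x, f (of n x) = g (of n x)) : f = g :=
  Module.DirectLimit.hom_ext fun n => LinearMap.ext fun x => h n x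

/-- A map out of the colimit. -/
noncomputable def desc {i : ℕ} {M : ModuleCat.{u} A} {N : Type*} [AddCommGroup N] [Module A N]
    (f : ∀ n, Ext (X.obj (op n)) M i →ₗ[A] N)
    (hf : ∀ n n' (h : n ≤ n') (x : Ext (X.obj (op n)) M i),
      f n' ((Ext.mk₀ (X.map (homOfLE h).op)).comp x (zero_add i)) = f n x) :
    ExtColim X i M →ₗ[A] N :=
  Module.DirectLimit.lift A ℕ _ (extTransition X i M) f hf

@[simp]
lemma desc_of {i : ℕ} {M : ModuleCat.{u} A} {N : Type*} [AddCommGroup N] [Module A N]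
    (f : ∀ n, Ext (X.obj (op n)) M i →ₗ[A] N)
    (hf : ∀ n n' (h : n ≤ n') (x : Ext (X.obj (op n)) M i),
      f n' ((Ext.mk₀ (X.map (homOfLE h).op)).comp x (zero_add i)) = f n x)
    (n : ℕ) (x : Ext (X.obj (op n)) M i) : desc f hf (of n x) = f n x :=
  Module.DirectLimit.lift_of (f := extTransition X i M) _ _ _

variable (X) in
/-- The map on colimits induced by the postcomposition with an `Ext`-class. -/
noncomputable def comp {i j i' : ℕ} {M N : ModuleCat.{u} A} (α : Ext M N j) (h : i + j = i') :
    ExtColim X i M →ₗ[A] ExtColim X i' N :=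
  desc (fun n => (of n).comp (α.postcompOfLinear A _ h)) fun n n' hn x => by
    simp only [LinearMap.comp_apply, LinearMap.flip_apply, Ext.bilinearCompOfLinear_apply_apply]
    rw [← of_mk₀_comp hn, Ext.comp_assoc _ _ _ _ h (by omega)]

@[simp]
lemma comp_of {i j i' : ℕ} {M N : ModuleCat.{u} A} (α : Ext M N j) (h : i + j = i') (n : ℕ)
    (x : Ext (X.obj (op n)) M i) : comp X α h (of n x) = of n (x.comp α h) := by
  simp [comp]

lemma comp_comp {i j i' j' i'' j'' : ℕ} {M N L : ModuleCat.{u} A} (α : Ext M N j)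
    (β : Ext N L j') (h : i + j = i') (h' : i' + j' = i'') (h'' : j + j' = j'')
    (x : ExtColim X i M) :
    comp X β h' (comp X α h x) = comp X (α.comp β h'') (by omega) x := by
  obtain ⟨n, x, rfl⟩ := exists_of x
  simp only [comp_of]
  rw [Ext.comp_assoc _ _ _ _ _ (by omega)]

lemma comp_zero {i j i' : ℕ} {M N : ModuleCat.{u} A} (h : i + j = i') (x : ExtColim X i M) :
    comp X (0 : Ext M N j) h x = 0 := by
  obtain ⟨n, x, rfl⟩ := exists_of x
  simp

variable (X) in
/-- The functoriality of the colimit. -/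
noncomputable abbrev map {M N : ModuleCat.{u} A} (f : M ⟶ N) (i : ℕ) :
    ExtColim X i M →ₗ[A] ExtColim X i N :=
  comp X (Ext.mk₀ f) (add_zero i)

lemma map_id {M : ModuleCat.{u} A} {i : ℕ} (x : ExtColim X i M) : map X (𝟙 M) i x = x := by
  obtain ⟨n, x, rfl⟩ := exists_of x
  simp

lemma map_map {M N L : ModuleCat.{u} A} (f : M ⟶ N) (g : N ⟶ L) {i : ℕ} (x : ExtColim X i M) :
    map X g i (map X f i x) = map X (f ≫ g) i x := by
  rw [comp_comp _ _ _ _ (add_zero 0), Ext.mk₀_comp_mk₀]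

lemma map_add {M N : ModuleCat.{u} A} (f g : M ⟶ N) {i : ℕ} (x : ExtColim X i M) :
    map X (f + g) i x = map X f i x + map X g i x := by
  obtain ⟨n, x, rfl⟩ := exists_of x
  simp [Ext.mk₀_add]

lemma map_smul {M N : ModuleCat.{u} A} (a : A) (f : M ⟶ N) {i : ℕ} (x : ExtColim X i M) :
    map X (a • f) i x = a • map X f i x := by
  obtain ⟨n, x, rfl⟩ := exists_of x
  simp [Ext.mk₀_smul]

/-- Isomorphic modules have isomorphic colimits. -/
noncomputable def mapEquiv {M N : ModuleCat.{u} A} (e : M ≅ N) (i : ℕ) :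
    ExtColim X i M ≃ₗ[A] ExtColim X i N :=
  LinearEquiv.ofLinearMap (map X e.hom i) (map X e.inv i)
    (LinearMap.ext fun x => by simp [map_map, map_id])
    (LinearMap.ext fun x => by simp [map_map, map_id])

section

variable {S : ShortComplex (ModuleCat.{u} A)}

variable (X) in
/-- The connecting map. -/
noncomputable abbrev δ (hS : S.ShortExact) (i : ℕ) :
    ExtColim X i S.X₃ →ₗ[A] ExtColim X (i + 1) S.X₁ :=
  comp X hS.extClass rfl

lemma exact_map (hS : S.ShortExact) (i : ℕ) : Function.Exact (map X S.f i) (map X S.g i) := by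
  intro x
  constructor
  · intro hx
    obtain ⟨n, x, rfl⟩ := exists_of x
    rw [comp_of, of_eq_zero_iff] at hx
    obtain ⟨n', h, hx⟩ := hx
    rw [← Ext.comp_assoc _ _ _ (zero_add i) _ (by omega)] at hx
    obtain ⟨y, hy⟩ := Ext.covariant_sequence_exact₂ _ hS _ hx
    exact ⟨of n' y, by rw [comp_of, hy, of_mk₀_comp]⟩
  · rintro ⟨y, rfl⟩
    rw [map_map, S.zero, map, Ext.mk₀_zero, comp_zero]

lemma exact_map_δ (hS : S.ShortExact) (i : ℕ) : Function.Exact (map X S.g i) (δ X hS i) := by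
  intro x
  constructor
  · intro hx
    obtain ⟨n, x, rfl⟩ := exists_of x
    rw [comp_of, of_eq_zero_iff] at hx
    obtain ⟨n', h, hx⟩ := hx
    rw [← Ext.comp_assoc _ _ _ (zero_add i) _ (by omega)] at hx
    obtain ⟨y, hy⟩ := Ext.covariant_sequence_exact₃ _ hS _ _ hx
    exact ⟨of n' y, by rw [comp_of, hy, of_mk₀_comp]⟩
  · rintro ⟨y, rfl⟩
    rw [comp_comp _ _ _ _ (zero_add 1), hS.comp_extClass, comp_zero]

lemma exact_δ_map (hS : S.ShortExact) (i : ℕ) : Function.Exact (δ X hS i) (map X S.f (i + 1)) := by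
  intro x
  constructor
  · intro hx
    obtain ⟨n, x, rfl⟩ := exists_of x
    rw [comp_of, of_eq_zero_iff] at hx
    obtain ⟨n', h, hx⟩ := hx
    rw [← Ext.comp_assoc _ _ _ (zero_add _) _ (by omega)] at hx
    obtain ⟨y, hy⟩ := Ext.covariant_sequence_exact₁ _ hS _ hx rfl
    exact ⟨of n' y, by rw [comp_of, hy, of_mk₀_comp]⟩
  · rintro ⟨y, rfl⟩
    rw [comp_comp _ _ _ _ (add_zero 1), hS.extClass_comp, comp_zero]

end

lemma subsingleton_of_injective (M : ModuleCat.{u} A) [Injective M] (i : ℕ) :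
    Subsingleton (ExtColim X (i + 1) M) :=
  subsingleton_of_forall_eq 0 fun x => by
    obtain ⟨n, x, rfl⟩ := exists_of x
    rw [Ext.eq_zero_of_injective x, LinearMap.map_zero]

end ExtColim

end ExtColim

section LocalCohomology

open Abelian Opposite

variable {A : Type} [CommRing A]

/-- The inverse system of the `A ⧸ J ^ n`. -/
noncomputable abbrev quotPow (J : Ideal A) : ℕᵒᵖ ⥤ ModuleCat.{0} A :=
  localCohomology.ringModIdeals (localCohomology.idealPowersDiagram J)

namespace ExtColim

variable (J : Ideal A) (i : ℕ) (M : ModuleCat.{0} A)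

/-- The diagram whose colimit is the local cohomology of a module. -/
noncomputable abbrev localCohomologyDiagram : (ℕᵒᵖ)ᵒᵖ ⥤ ModuleCat.{0} A :=
  localCohomology.diagram (localCohomology.idealPowersDiagram J) i ⋙ (evaluation _ _).obj M

/-- The colimit cocone defining the local cohomology of a module. -/
noncomputable abbrev localCohomologyCocone : Limits.Cocone (localCohomologyDiagram J i M) :=
  ((evaluation _ _).obj M).mapCocone
    (Limits.colimit.cocone (localCohomology.diagram (localCohomology.idealPowersDiagram J) i))

/-- The cocone defining the local cohomology is colimiting. -/
noncomputable def isColimitLocalCohomologyCocone :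
    Limits.IsColimit (localCohomologyCocone J i M) :=
  Limits.isColimitOfPreserves _ (Limits.colimit.isColimit _)

/-- The canonical maps to local cohomology. -/
noncomputable def localCohomologyι (n : ℕ) :
    ((_root_.Ext A (ModuleCat.{0} A) i).obj (op ((quotPow J).obj (op n)))).obj M →ₗ[A]
      (localCohomology J i).obj M :=
  ((localCohomologyCocone J i M).ι.app (op (op n))).hom

lemma localCohomologyι_map (n n' : ℕ) (h : n ≤ n')
    (x : ((_root_.Ext A (ModuleCat.{0} A) i).obj (op ((quotPow J).obj (op n)))).obj M) :
    localCohomologyι J i M n' (((_root_.Ext A (ModuleCat.{0} A) i).map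
      ((quotPow J).map (homOfLE h).op).op).app M x) = localCohomologyι J i M n x :=
  ConcreteCategory.congr_hom ((localCohomologyCocone J i M).w (homOfLE h).op.op) x

lemma exists_localCohomologyι (y : (localCohomology J i).obj M) :
    ∃ n x, localCohomologyι J i M n x = y := by
  obtain ⟨j, y, rfl⟩ := Limits.Concrete.isColimit_exists_rep (localCohomologyDiagram J i M)
    (isColimitLocalCohomologyCocone J i M) y
  exact ⟨j.unop.unop, y, rfl⟩

lemma exists_map_eq_zero_of_localCohomologyι {n : ℕ}
    (x : ((_root_.Ext A (ModuleCat.{0} A) i).obj (op ((quotPow J).obj (op n)))).obj M)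
    (hx : localCohomologyι J i M n x = 0) :
    ∃ n', ∃ h : n ≤ n', ((_root_.Ext A (ModuleCat.{0} A) i).map
      ((quotPow J).map (homOfLE h).op).op).app M x = 0 := by
  obtain ⟨k, f, g, hfg⟩ := Limits.Concrete.isColimit_exists_of_rep_eq
    (localCohomologyDiagram J i M) (i := op (op n)) (j := op (op n))
    (isColimitLocalCohomologyCocone J i M) x
    (0 : ((_root_.Ext A (ModuleCat.{0} A) i).obj (op ((quotPow J).obj (op n)))).obj M)
    (hx.trans (LinearMap.map_zero (localCohomologyι J i M n)).symm)
  exact ⟨k.unop.unop, leOfHom f.unop.unop,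
    hfg.trans (LinearMap.map_zero ((localCohomologyDiagram J i M).map g).hom)⟩

/-- The comparison map from the colimit of `Ext`-modules to local cohomology. -/
noncomputable def toLocalCohomology :
    ExtColim (quotPow J) i M →ₗ[A] (localCohomology J i).obj M :=
  desc (fun n => (localCohomologyι J i M n).comp
      (extLinearEquiv A ((quotPow J).obj (op n)) M i).symm.toLinearMap) fun n n' h x => by
    obtain ⟨x, rfl⟩ := (extLinearEquiv A ((quotPow J).obj (op n)) M i).surjective x
    simp only [LinearMap.comp_apply, LinearEquiv.coe_coe, LinearEquiv.symm_apply_apply]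
    rw [← extLinearEquiv_map, LinearEquiv.symm_apply_apply, localCohomologyι_map]

lemma toLocalCohomology_of (n : ℕ)
    (x : ((_root_.Ext A (ModuleCat.{0} A) i).obj (op ((quotPow J).obj (op n)))).obj M) :
    toLocalCohomology J i M (of n (extLinearEquiv A ((quotPow J).obj (op n)) M i x)) =
      localCohomologyι J i M n x := by
  simp only [toLocalCohomology, desc_of, LinearMap.comp_apply, LinearEquiv.coe_coe,
    LinearEquiv.symm_apply_apply]

lemma toLocalCohomology_bijective : Function.Bijective (toLocalCohomology J i M) := by
  constructor
  · rw [injective_iff_map_eq_zero]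
    intro x hx
    obtain ⟨n, x, rfl⟩ := exists_of x
    obtain ⟨x, rfl⟩ := (extLinearEquiv A ((quotPow J).obj (op n)) M i).surjective x
    rw [toLocalCohomology_of] at hx
    obtain ⟨n', h, hn'⟩ := exists_map_eq_zero_of_localCohomologyι J i M x hx
    rw [of_eq_zero_iff]
    refine ⟨n', h, ?_⟩
    rw [← extLinearEquiv_map, hn', LinearEquiv.map_zero]
  · intro y
    obtain ⟨n, y, rfl⟩ := exists_localCohomologyι J i M y
    exact ⟨_, toLocalCohomology_of J i M n y⟩

/-- Local cohomology is the colimit of the modules `Ext (A ⧸ J ^ n) M i`. -/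
noncomputable def equivLocalCohomology :
    ExtColim (quotPow J) i M ≃ₗ[A] (localCohomology J i).obj M :=
  LinearEquiv.ofBijective _ (toLocalCohomology_bijective J i M)

end ExtColim

end LocalCohomology

section DegreeZero

open Abelian Opposite

variable {A : Type} [CommRing A] (J : Ideal A)

/-- The class of `1` in `A ⧸ J ^ n`. -/
def quotPowOne (n : ℕ) : (quotPow J).obj (op n) :=
  (Submodule.Quotient.mk (1 : A) : A ⧸ J ^ n)

lemma quotPow_map_quotPowOne {n n' : ℕ} (h : n ≤ n') :
    (quotPow J).map (homOfLE h).op (quotPowOne J n') = quotPowOne J n := rfl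

variable {J} in
lemma exists_smul_quotPowOne {n : ℕ} (y : (quotPow J).obj (op n)) :
    ∃ a : A, a • quotPowOne J n = y := by
  obtain ⟨a, rfl⟩ := Submodule.Quotient.mk_surjective (J ^ n) y
  refine ⟨a, ?_⟩
  change Submodule.Quotient.mk (a • (1 : A)) = _
  rw [smul_eq_mul, mul_one]
  rfl

lemma smul_quotPowOne {n : ℕ} {a : A} (ha : a ∈ J ^ n) : a • quotPowOne J n = 0 := by
  change Submodule.Quotient.mk (a • (1 : A)) = _
  rw [smul_eq_mul, mul_one]
  exact (Submodule.Quotient.mk_eq_zero _).2 ha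

/-- The linear map `A ⧸ J ^ n → M` attached to an element killed by `J ^ n`. -/
def quotPowDesc {n : ℕ} {M : ModuleCat.{0} A} (x : M) (hx : ∀ a ∈ J ^ n, a • x = 0) :
    (quotPow J).obj (op n) ⟶ M :=
  ModuleCat.ofHom ((J ^ n).liftQ (LinearMap.toSpanSingleton A M x) hx)

lemma quotPowDesc_quotPowOne {n : ℕ} {M : ModuleCat.{0} A} (x : M)
    (hx : ∀ a ∈ J ^ n, a • x = 0) : quotPowDesc J x hx (quotPowOne J n) = x := one_smul A x

namespace ExtColim

/-- The identification of the colimit of the `Hom (A ⧸ J ^ n, M)` to a submodule of `M`. -/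
noncomputable def eval (M : ModuleCat.{0} A) : ExtColim (quotPow J) 0 M →ₗ[A] M :=
  desc (fun n =>
    { toFun x := (Ext.linearEquiv₀ (R := A) x).hom (quotPowOne J n)
      map_add' x y := by rw [_root_.map_add]; rfl
      map_smul' a x := by rw [_root_.map_smul]; rfl }) fun n n' h x => by
    obtain ⟨f, rfl⟩ := (Ext.mk₀_bijective _ _).2 x
    rw [Ext.mk₀_comp_mk₀]
    simp only [LinearMap.coe_mk, AddHom.coe_mk, ← Ext.linearEquiv₀_symm_apply (R := A),
      LinearEquiv.apply_symm_apply]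
    rfl

variable {J}

lemma eval_of_mk₀ {M : ModuleCat.{0} A} {n : ℕ} (f : (quotPow J).obj (op n) ⟶ M) :
    eval J M (of n (Ext.mk₀ f)) = f (quotPowOne J n) := by
  simp only [eval, desc_of, LinearMap.coe_mk, AddHom.coe_mk]
  rw [← Ext.linearEquiv₀_symm_apply (R := A), LinearEquiv.apply_symm_apply]

lemma exists_of_mk₀ {M : ModuleCat.{0} A} (x : ExtColim (quotPow J) 0 M) :
    ∃ n f, of n (Ext.mk₀ f) = x := by
  obtain ⟨n, x, rfl⟩ := exists_of x
  obtain ⟨f, rfl⟩ := (Ext.mk₀_bijective _ _).2 x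
  exact ⟨n, f, rfl⟩

lemma eval_map {M N : ModuleCat.{0} A} (f : M ⟶ N) (x : ExtColim (quotPow J) 0 M) :
    eval J N (map _ f 0 x) = f (eval J M x) := by
  obtain ⟨n, g, rfl⟩ := exists_of_mk₀ x
  rw [comp_of, Ext.mk₀_comp_mk₀, eval_of_mk₀, eval_of_mk₀]
  rfl

lemma eval_injective (M : ModuleCat.{0} A) : Function.Injective (eval J M) := by
  rw [injective_iff_map_eq_zero]
  intro x hx
  obtain ⟨n, f, rfl⟩ := exists_of_mk₀ x
  rw [eval_of_mk₀] at hx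
  have : f = 0 := by
    ext y
    obtain ⟨a, rfl⟩ := exists_smul_quotPowOne y
    rw [_root_.map_smul, hx, smul_zero]
    rfl
  rw [this, Ext.mk₀_zero, _root_.map_zero]

lemma mem_range_eval {M : ModuleCat.{0} A} {x : M} :
    x ∈ LinearMap.range (eval J M) ↔ ∃ n, ∀ a ∈ J ^ n, a • x = 0 := by
  constructor
  · rintro ⟨x, rfl⟩
    obtain ⟨n, f, rfl⟩ := exists_of_mk₀ x
    refine ⟨n, fun a ha => ?_⟩
    rw [eval_of_mk₀, ← _root_.map_smul, smul_quotPowOne J ha, _root_.map_zero]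
  · rintro ⟨n, hn⟩
    exact ⟨of n (Ext.mk₀ (quotPowDesc J x hn)), by
      rw [eval_of_mk₀, quotPowDesc_quotPowOne]⟩

end ExtColim

end DegreeZero

section Coinduced

open Abelian Opposite

variable {A : Type} [CommRing A]

/-- The module of linear maps `N → E`. -/
abbrev homModule (N E : Type) [AddCommGroup N] [Module A N] [AddCommGroup E] [Module A E] :
    ModuleCat.{0} A :=
  ModuleCat.of A (N →ₗ[A] E)

variable (E : Type) [AddCommGroup E] [Module A E]

lemma homModule_injective_of_free [Module.Injective A E] (n : ℕ) :
    Injective (homModule (A := A) (Fin n → A) E) :=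
  Injective.of_iso (LinearEquiv.toModuleIso ((Pi.basisFun A (Fin n)).constr A))
    (Module.injective_object_of_injective_module A (Fin n → E))

/-- The short complex `Hom(L, E) → Hom(F, E) → Hom(K, E)` attached to `g : F → L` and to the
kernel `K` of `g`. -/
abbrev homShortComplex {F L : Type} [AddCommGroup F] [Module A F] [AddCommGroup L] [Module A L]
    (g : F →ₗ[A] L) : ShortComplex (ModuleCat.{0} A) where
  X₁ := homModule (A := A) L E
  X₂ := homModule (A := A) F E
  X₃ := homModule (A := A) (LinearMap.ker g) E
  f := ModuleCat.ofHom (LinearMap.lcomp A E g)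
  g := ModuleCat.ofHom (LinearMap.lcomp A E (LinearMap.ker g).subtype)
  zero := by
    ext φ : 2
    refine LinearMap.ext fun x => ?_
    change φ (g x) = 0
    rw [x.2, map_zero]

lemma homShortComplex_shortExact [Module.Injective A E] {F L : Type} [AddCommGroup F] [Module A F]
    [AddCommGroup L] [Module A L] {g : F →ₗ[A] L} (hg : Function.Surjective g) :
    (homShortComplex E g).ShortExact := by
  apply ModuleCat.shortComplex_shortExact
  · exact LinearMap.exact_lcomp_of_exact_of_surjective E g.exact_subtype_ker_map hg
  · intro φ ψ h
    ext x
    obtain ⟨y, rfl⟩ := hg x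
    exact LinearMap.congr_fun h y
  · intro φ
    exact Module.Injective.extension_property A E _ _ _ (Submodule.injective_subtype _) φ

/-- A linear map defined on a submodule of a finite module, with values in an injective module
and killed by a power of `J`, extends to a map killed by a power of `J`. -/
lemma exists_extension_of_pow_smul [IsNoetherianRing A] [Module.Injective A E] (J : Ideal A)
    {F : Type} [AddCommGroup F] [Module A F] [Module.Finite A F] (K : Submodule A F)
    (φ : K →ₗ[A] E) (n : ℕ) (hφ : ∀ a ∈ J ^ n, a • φ = 0) :
    ∃ ψ : F →ₗ[A] E, ψ.comp K.subtype = φ ∧ ∃ n', ∀ a ∈ J ^ n', a • ψ = 0 := by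
  obtain ⟨k, hk⟩ := Ideal.exists_pow_inf_eq_pow_smul J K
  let T : Submodule A F := J ^ (n + k) • ⊤
  have hT : T.comap K.subtype ≤ LinearMap.ker φ := by
    intro x hx
    have h1 : (x : F) ∈ J ^ n • (J ^ k • ⊤ ⊓ K) := by
      have := hk (n + k) (by omega)
      rw [Nat.add_sub_cancel] at this
      rw [← this]
      exact ⟨hx, x.2⟩
    have h2 : (x : F) ∈ J ^ n • K := Submodule.smul_mono le_rfl inf_le_right h1
    have h3 : J ^ n • K ≤ (LinearMap.ker φ).map K.subtype := by
      rw [Submodule.smul_le]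
      intro a ha y hy
      exact ⟨a • ⟨y, hy⟩, by
        rw [SetLike.mem_coe, LinearMap.mem_ker, map_smul]
        exact LinearMap.congr_fun (hφ a ha) _, rfl⟩
    obtain ⟨y, hy, hxy⟩ := h3 h2
    rwa [← Subtype.ext hxy]
  obtain ⟨ψ, hψ⟩ := Module.Injective.extension_property A E _ _
    (Submodule.mapQ (T.comap K.subtype) T K.subtype le_rfl)
    (by
      rw [← LinearMap.ker_eq_bot, Submodule.mapQ, Submodule.ker_liftQ, LinearMap.ker_comp,
        Submodule.ker_mkQ, Submodule.mkQ_map_self])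
    ((T.comap K.subtype).liftQ φ hT)
  refine ⟨ψ.comp T.mkQ, ?_, n + k, fun a ha => ?_⟩
  · ext x
    exact LinearMap.congr_fun hψ (Submodule.Quotient.mk x)
  · ext x
    change a • ψ (T.mkQ x) = 0
    rw [← map_smul, ← map_smul, Submodule.mkQ_apply,
      (Submodule.Quotient.mk_eq_zero T).2 (Submodule.smul_mem_smul ha Submodule.mem_top), map_zero]

lemma subsingleton_extColim_homModule [IsNoetherianRing A] [Module.Injective A E] (J : Ideal A)
    (i : ℕ) : ∀ (L : Type) [AddCommGroup L] [Module A L] [Module.Finite A L],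
      Subsingleton (ExtColim (quotPow J) (i + 1) (homModule (A := A) L E)) := by
  induction i with
  | zero =>
    intro L _ _ _
    obtain ⟨n, g, hg⟩ := Module.Finite.exists_fin' A L
    have := homModule_injective_of_free (A := A) E n
    have hS := homShortComplex_shortExact E hg
    have h0 := ExtColim.subsingleton_of_injective (X := quotPow J) (homShortComplex E g).X₂ 0
    refine subsingleton_of_forall_eq 0 fun x => ?_
    obtain ⟨y, rfl⟩ := (ExtColim.exact_δ_map (X := quotPow J) hS 0 x).1 (Subsingleton.elim _ _)
    refine (ExtColim.exact_map_δ hS 0 y).2 ?_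
    obtain ⟨n, hn⟩ := ExtColim.mem_range_eval.1 ⟨y, rfl⟩
    obtain ⟨ψ, hψ, hψ'⟩ := exists_extension_of_pow_smul E J _ _ n hn
    obtain ⟨z, hz⟩ := ExtColim.mem_range_eval (M := (homShortComplex E g).X₂).2 hψ'
    refine ⟨z, ExtColim.eval_injective _ ?_⟩
    rw [ExtColim.eval_map, hz]
    exact hψ
  | succ i hi =>
    intro L _ _ _
    obtain ⟨n, g, hg⟩ := Module.Finite.exists_fin' A L
    have := homModule_injective_of_free (A := A) E n
    have hS := homShortComplex_shortExact E hg
    have h0 := ExtColim.subsingleton_of_injective (X := quotPow J) (homShortComplex E g).X₂ (i + 1)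
    have h1 := hi (LinearMap.ker g)
    refine subsingleton_of_forall_eq 0 fun x => ?_
    obtain ⟨y, rfl⟩ := (ExtColim.exact_δ_map (X := quotPow J) hS (i + 1) x).1
      (Subsingleton.elim _ _)
    rw [Subsingleton.elim y 0, map_zero]

end Coinduced

section BaseIndependence

open Abelian Opposite

lemma exists_addEquiv_of_range_eq {X Y G : Type*} [AddCommGroup X] [AddCommGroup Y]
    [AddCommGroup G] {f : X →+ G} {g : Y →+ G} (hf : Function.Injective f)
    (hg : Function.Injective g) (h : f.range = g.range) :
    ∃ e : X ≃+ Y, ∀ x, g (e x) = f x := by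
  refine ⟨(AddMonoidHom.ofInjective hf).trans ((AddEquiv.addSubgroupCongr h).trans
    (AddMonoidHom.ofInjective hg).symm), fun x => ?_⟩
  have := (AddMonoidHom.ofInjective hg).apply_symm_apply
    (AddEquiv.addSubgroupCongr h (AddMonoidHom.ofInjective hf x))
  exact congr_arg Subtype.val this

lemma exists_addEquiv_of_exact {X₁ X₂ X₃ Y₁ Y₂ Y₃ : Type*} [AddCommGroup X₁] [AddCommGroup X₂]
    [AddCommGroup X₃] [AddCommGroup Y₁] [AddCommGroup Y₂] [AddCommGroup Y₃]
    {f : X₁ →+ X₂} {g : X₂ →+ X₃} {f' : Y₁ →+ Y₂} {g' : Y₂ →+ Y₃}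
    (hfg : Function.Exact f g) (hg : Function.Surjective g)
    (hfg' : Function.Exact f' g') (hg' : Function.Surjective g')
    (e₁ : X₁ ≃+ Y₁) (e₂ : X₂ ≃+ Y₂) (h : ∀ x, e₂ (f x) = f' (e₁ x)) :
    ∃ e₃ : X₃ ≃+ Y₃, ∀ x, e₃ (g x) = g' (e₂ x) := by
  have hker : ∀ x, g x = 0 ↔ g' (e₂ x) = 0 := fun x => by
    rw [hfg x, hfg' (e₂ x)]
    constructor
    · rintro ⟨y, rfl⟩
      exact ⟨e₁ y, (h y).symm⟩
    · rintro ⟨y, hy⟩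
      refine ⟨e₁.symm y, e₂.injective ?_⟩
      rw [h, e₁.apply_symm_apply, hy]
  have hk : g.ker = (g'.comp e₂.toAddMonoidHom).ker := by
    ext x
    exact hker x
  refine ⟨(QuotientAddGroup.quotientKerEquivOfSurjective g hg).symm.trans
    ((QuotientAddGroup.quotientAddEquivOfEq hk).trans
      (QuotientAddGroup.quotientKerEquivOfSurjective (g'.comp e₂.toAddMonoidHom)
        (hg'.comp e₂.surjective))), fun x => ?_⟩
  have : (QuotientAddGroup.quotientKerEquivOfSurjective g hg).symm (g x) =
      QuotientAddGroup.mk x := by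
    rw [AddEquiv.symm_apply_eq]
    rfl
  rw [AddEquiv.trans_apply, this]
  rfl

variable {A B : Type} [CommRing A] [CommRing B] (f : A →+* B)

/-- The embedding of a module in a coinduced injective module. -/
noncomputable abbrev toCoinduced (M : ModuleCat.{0} B) :
    M ⟶ (ModuleCat.coextendScalars f).obj
      (Injective.under ((ModuleCat.restrictScalars f).obj M)) :=
  (ModuleCat.restrictCoextendScalarsAdj f).homEquiv _ _
    (Injective.ι ((ModuleCat.restrictScalars f).obj M))

instance (M : ModuleCat.{0} B) : Mono (toCoinduced f M) := by
  have h : (ModuleCat.restrictScalars f).map (toCoinduced f M) ≫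
      (ModuleCat.restrictCoextendScalarsAdj f).counit.app _ =
      Injective.ι ((ModuleCat.restrictScalars f).obj M) :=
    ((ModuleCat.restrictCoextendScalarsAdj f).homEquiv_counit _ _ _).symm.trans
      (Equiv.symm_apply_apply _ _)
  have : Mono ((ModuleCat.restrictScalars f).map (toCoinduced f M)) := mono_of_mono_fac h
  exact (ModuleCat.restrictScalars f).mono_of_mono_map this

instance (E : ModuleCat.{0} A) [Injective E] : Injective ((ModuleCat.coextendScalars f).obj E) :=
  Injective.injective_of_adjoint (ModuleCat.restrictCoextendScalarsAdj f) E

/-- A coinduced module, as a module of linear maps. -/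
noncomputable def coinducedIso (E : ModuleCat.{0} A) :
    (ModuleCat.restrictScalars f).obj ((ModuleCat.coextendScalars f).obj E) ≅
      homModule (A := A) ((ModuleCat.restrictScalars f).obj (ModuleCat.of B B)) E :=
  LinearEquiv.toModuleIso
    ({ toFun := fun φ => φ
       invFun := fun φ => φ
       left_inv := fun _ => rfl
       right_inv := fun _ => rfl
       map_add' := fun _ _ => rfl
       map_smul' := fun a φ => by
        refine LinearMap.ext fun x => ?_
        refine Eq.trans ?_ (LinearMap.map_smul φ a x)
        exact congr_arg (DFunLike.coe
          (F := (ModuleCat.restrictScalars f).obj (ModuleCat.of B B) →ₗ[A] E) φ)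
          (mul_comm (G := B) x (f a)) } :
      ((ModuleCat.restrictScalars f).obj ((ModuleCat.coextendScalars f).obj E)) ≃ₗ[A]
        homModule (A := A) ((ModuleCat.restrictScalars f).obj (ModuleCat.of B B)) E)

variable {f}

lemma subsingleton_extColim_coinduced [IsNoetherianRing A] (hf : Function.Surjective f)
    (J : Ideal A) (E : ModuleCat.{0} A) [Injective E] (i : ℕ) :
    Subsingleton (ExtColim (quotPow J) (i + 1)
      ((ModuleCat.restrictScalars f).obj ((ModuleCat.coextendScalars f).obj E))) := by
  have : Module.Injective A E := Module.injective_module_of_injective_object A E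
  have : Module.Finite A ((ModuleCat.restrictScalars f).obj (ModuleCat.of B B)) := by
    exact Module.Finite.of_surjective
      ({ toFun := fun a => f a
         map_add' := map_add f
         map_smul' := map_mul f } :
        A →ₗ[A] ((ModuleCat.restrictScalars f).obj (ModuleCat.of B B))) hf
  have := subsingleton_extColim_homModule E J i
    ((ModuleCat.restrictScalars f).obj (ModuleCat.of B B))
  exact (ExtColim.mapEquiv (X := quotPow J) (coinducedIso f E) (i + 1)).injective.subsingleton

lemma exists_addEquiv_extColim_zero (hf : Function.Surjective f) (J : Ideal A)
    (M : ModuleCat.{0} B) :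
    ∃ e : ExtColim (quotPow (J.map f)) 0 M ≃+
      ExtColim (quotPow J) 0 ((ModuleCat.restrictScalars f).obj M),
      ∀ x, ExtColim.eval J _ (e x) = ExtColim.eval (J.map f) M x := by
  refine exists_addEquiv_of_range_eq (G := M)
    (f := (ExtColim.eval (J.map f) M).toAddMonoidHom)
    (g := (ExtColim.eval J ((ModuleCat.restrictScalars f).obj M)).toAddMonoidHom)
    (ExtColim.eval_injective _) (ExtColim.eval_injective _) ?_
  ext x
  refine (ExtColim.mem_range_eval (M := M) (x := x)).trans (Iff.trans ?_
    (ExtColim.mem_range_eval (M := (ModuleCat.restrictScalars f).obj M) (x := x)).symm)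
  refine exists_congr fun n => ?_
  rw [← Ideal.map_pow]
  constructor
  · intro h a ha
    exact h _ (Ideal.mem_map_of_mem f ha)
  · intro h b hb
    obtain ⟨a, ha, rfl⟩ := (Ideal.mem_map_iff_of_surjective f hf).1 hb
    exact h a ha

lemma δ_bijective (X : ℕᵒᵖ ⥤ ModuleCat.{0} A) {S : ShortComplex (ModuleCat.{0} A)}
    (hS : S.ShortExact) (i : ℕ) [Subsingleton (ExtColim X i S.X₂)]
    [Subsingleton (ExtColim X (i + 1) S.X₂)] : Function.Bijective (ExtColim.δ X hS i) := by
  constructor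
  · rw [injective_iff_map_eq_zero]
    intro x hx
    obtain ⟨y, rfl⟩ := (ExtColim.exact_map_δ hS i x).1 hx
    rw [Subsingleton.elim y 0, map_zero]
  · intro x
    exact (ExtColim.exact_δ_map hS i x).1 (Subsingleton.elim _ _)

lemma δ_surjective (X : ℕᵒᵖ ⥤ ModuleCat.{0} A) {S : ShortComplex (ModuleCat.{0} A)}
    (hS : S.ShortExact) (i : ℕ) [Subsingleton (ExtColim X (i + 1) S.X₂)] :
    Function.Surjective (ExtColim.δ X hS i) :=
  fun x => (ExtColim.exact_δ_map hS i x).1 (Subsingleton.elim _ _)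

lemma extColim_zero_map_eq {J : Ideal A} {M N : ModuleCat.{0} B} (g : M ⟶ N)
    {e : ExtColim (quotPow (J.map f)) 0 M ≃+
      ExtColim (quotPow J) 0 ((ModuleCat.restrictScalars f).obj M)}
    (he : ∀ x, ExtColim.eval J _ (e x) = ExtColim.eval (J.map f) M x)
    {e' : ExtColim (quotPow (J.map f)) 0 N ≃+
      ExtColim (quotPow J) 0 ((ModuleCat.restrictScalars f).obj N)}
    (he' : ∀ x, ExtColim.eval J _ (e' x) = ExtColim.eval (J.map f) N x)
    (x : ExtColim (quotPow (J.map f)) 0 M) :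
    e' (ExtColim.map _ g 0 x) =
      ExtColim.map _ ((ModuleCat.restrictScalars f).map g) 0 (e x) := by
  apply ExtColim.eval_injective
  rw [he', ExtColim.eval_map, ExtColim.eval_map, he]
  rfl

lemma extColim_zero_smul {J : Ideal A} {M : ModuleCat.{0} B}
    {e : ExtColim (quotPow (J.map f)) 0 M ≃+
      ExtColim (quotPow J) 0 ((ModuleCat.restrictScalars f).obj M)}
    (he : ∀ x, ExtColim.eval J _ (e x) = ExtColim.eval (J.map f) M x) (a : A)
    (x : ExtColim (quotPow (J.map f)) 0 M) : e (f a • x) = a • e x := by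
  apply ExtColim.eval_injective
  rw [he, map_smul, map_smul, he]
  rfl

lemma exists_addEquiv_extColim [IsNoetherianRing A] (hf : Function.Surjective f) (J : Ideal A)
    (i : ℕ) (M : ModuleCat.{0} B) :
    ∃ e : ExtColim (quotPow (J.map f)) i M ≃+
      ExtColim (quotPow J) i ((ModuleCat.restrictScalars f).obj M),
      ∀ a x, e (f a • x) = a • e x := by
  induction i generalizing M with
  | zero =>
    obtain ⟨e, he⟩ := exists_addEquiv_extColim_zero hf J M
    exact ⟨e, extColim_zero_smul he⟩
  | succ i ih =>
  let S := ShortComplex.mk (toCoinduced f M) (Limits.cokernel.π (toCoinduced f M)) (by simp)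
  have hS : S.ShortExact :=
    { exact := ShortComplex.exact_of_g_is_cokernel _ (Limits.cokernelIsCokernel (toCoinduced f M))
      mono_f := inferInstanceAs (Mono (toCoinduced f M))
      epi_g := inferInstanceAs (Epi (Limits.cokernel.π (toCoinduced f M))) }
  have hT : (S.map (ModuleCat.restrictScalars f)).ShortExact :=
    hS.map_of_exact (ModuleCat.restrictScalars f)
  have hB (j : ℕ) : Subsingleton (ExtColim (quotPow (J.map f)) (j + 1) S.X₂) := by
    have : Injective S.X₂ := by dsimp [S]; infer_instance
    exact ExtColim.subsingleton_of_injective _ _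
  have hA (j : ℕ) : Subsingleton (ExtColim (quotPow J) (j + 1)
      (S.map (ModuleCat.restrictScalars f)).X₂) :=
    subsingleton_extColim_coinduced hf J _ j
  obtain _ | i := i
  · obtain ⟨e₂, he₂⟩ := exists_addEquiv_extColim_zero hf J S.X₂
    obtain ⟨e₃, he₃⟩ := exists_addEquiv_extColim_zero hf J S.X₃
    obtain ⟨e, he⟩ := exists_addEquiv_of_exact
      (f := (ExtColim.map (quotPow (J.map f)) S.g 0).toAddMonoidHom)
      (g := (ExtColim.δ (quotPow (J.map f)) hS 0).toAddMonoidHom)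
      (f' := (ExtColim.map (quotPow J) (S.map (ModuleCat.restrictScalars f)).g 0).toAddMonoidHom)
      (g' := (ExtColim.δ (quotPow J) hT 0).toAddMonoidHom)
      (ExtColim.exact_map_δ hS 0) (δ_surjective _ hS 0)
      (ExtColim.exact_map_δ hT 0) (δ_surjective _ hT 0) e₂ e₃
      (extColim_zero_map_eq S.g he₂ he₃)
    refine ⟨e, fun a x => ?_⟩
    obtain ⟨x, rfl⟩ := δ_surjective _ hS 0 x
    have h₃ := extColim_zero_smul he₃ a x
    rw [← map_smul]
    refine (he _).trans (Eq.trans ?_ (congr_arg (a • ·) (he x)).symm)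
    refine (congr_arg (ExtColim.δ (quotPow J) hT 0) h₃).trans (map_smul _ _ _)
  · obtain ⟨e, he⟩ := ih S.X₃
    have h₁ := δ_bijective (quotPow (J.map f)) hS (i + 1)
    have h₂ := δ_bijective (quotPow J) hT (i + 1)
    refine ⟨(LinearEquiv.ofBijective _ h₁).symm.toAddEquiv.trans
      (e.trans (LinearEquiv.ofBijective _ h₂).toAddEquiv), fun a x => ?_⟩
    refine Eq.trans ?_ (map_smul (LinearEquiv.ofBijective _ h₂) a _)
    refine congr_arg (LinearEquiv.ofBijective _ h₂) ((congr_arg e ?_).trans (he a _))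
    exact map_smul (LinearEquiv.ofBijective _ h₁).symm (f a) x

end BaseIndependence

section Regular

open Abelian Opposite RingTheory.Sequence Pointwise

variable {A : Type} [CommRing A]

lemma mem_ofList {r : A} {rs : List A} (hr : r ∈ rs) : r ∈ Ideal.ofList rs :=
  Ideal.subset_span hr

lemma hasProjectiveDimensionLT_of_isWeaklyRegular (rs : List A) : ∀ (M : ModuleCat.{0} A) (n : ℕ)
    [HasProjectiveDimensionLT M (n + 1)], IsWeaklyRegular M rs →
      HasProjectiveDimensionLT (ModuleCat.of A (M ⧸ (Ideal.ofList rs • ⊤ : Submodule A M)))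
        (n + rs.length + 1) := by
  induction rs with
  | nil =>
    intro M n _ _
    have e : (M ⧸ (Ideal.ofList [] • ⊤ : Submodule A M)) ≃ₗ[A] M :=
      Submodule.quotEquivOfEqBot _ (by
        rw [Ideal.ofList_nil (R := A), Submodule.bot_smul])
    exact hasProjectiveDimensionLT_of_iso (X := M) e.symm.toModuleIso _
  | cons r rs ih =>
    intro M n _ hM
    obtain ⟨hr, hrs⟩ := (isWeaklyRegular_cons_iff M r rs).1 hM
    have : HasProjectiveDimensionLT (ModuleCat.of A (QuotSMulTop r M)) (n + 1 + 1) :=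
      hr.smulShortComplex_shortExact.hasProjectiveDimensionLT_X₃ (n + 1)
        ‹HasProjectiveDimensionLT M (n + 1)›
        (hasProjectiveDimensionLT_of_ge M (n + 1) (n + 1 + 1) (by omega))
    have := ih (ModuleCat.of A (QuotSMulTop r M)) (n + 1) hrs
    rw [List.length_cons, show n + (rs.length + 1) + 1 = n + 1 + rs.length + 1 by omega]
    exact hasProjectiveDimensionLT_of_iso
      (Submodule.quotOfListConsSMulTopEquivQuotSMulTopInner M r rs).symm.toModuleIso _

lemma ext_eq_zero_of_isWeaklyRegular (N : ModuleCat.{0} A) (rs : List A) :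
    ∀ (M : ModuleCat.{0} A) (_ : IsWeaklyRegular M rs)
      (_ : ∀ r ∈ rs, ∃ n : ℕ, ∀ x : N, r ^ n • x = 0) (i : ℕ) (_ : i < rs.length) (x : Ext N M i),
      x = 0 := by
  induction rs with
  | nil =>
    intro M _ _ i hi
    simp at hi
  | cons r rs ih =>
    intro M hM hN i hi x
    obtain ⟨hr, hrs⟩ := (isWeaklyRegular_cons_iff M r rs).1 hM
    have hS := hr.smulShortComplex_shortExact
    have hinj (y : Ext N M i) (hy : r • y = 0) : y = 0 := by
      have hy' : y.comp (Ext.mk₀ (r • 𝟙 M)) (add_zero i) = 0 := by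
        rw [← Ext.smul_eq_comp_mk₀]
        exact hy
      obtain _ | i := i
      · obtain ⟨f, rfl⟩ := (Ext.mk₀_bijective _ _).2 y
        have : Mono (r • 𝟙 M) := hS.mono_f
        rw [Ext.mk₀_comp_mk₀, Ext.mk₀_eq_zero_iff] at hy'
        rw [(cancel_mono (r • 𝟙 M)).1 (hy'.trans Limits.zero_comp.symm), Ext.mk₀_zero]
      · obtain ⟨z, rfl⟩ := Ext.covariant_sequence_exact₁ _ hS y hy' rfl
        have hz : z = 0 := ih (ModuleCat.of A (QuotSMulTop r M)) hrs
          (fun r hr => hN r (List.mem_cons_of_mem _ hr)) i (by simpa using hi) z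
        rw [hz, Ext.zero_comp]
        rfl
    obtain ⟨n, hn⟩ := hN r List.mem_cons_self
    have hx : r ^ n • x = 0 := by
      have h0 : r ^ n • 𝟙 N = 0 := by
        ext y
        exact hn y
      have : x = (Ext.mk₀ (𝟙 N)).comp x (zero_add i) := (Ext.mk₀_id_comp x).symm
      rw [this, ← Ext.smul_comp, ← Ext.mk₀_smul, h0, Ext.mk₀_zero, Ext.zero_comp]
    clear hn
    induction n with
    | zero => simpa using hx
    | succ n ihn =>
      rw [pow_succ', mul_smul] at hx
      exact ihn (hinj _ hx)

namespace ExtColim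

lemma subsingleton_of_lt_length {rs : List A} {M : ModuleCat.{0} A} (hM : IsWeaklyRegular M rs)
    {i : ℕ} (hi : i < rs.length) :
    Subsingleton (ExtColim (quotPow (Ideal.ofList rs)) i M) := by
  refine subsingleton_of_forall_eq 0 fun x => ?_
  obtain ⟨n, x, rfl⟩ := exists_of x
  rw [ext_eq_zero_of_isWeaklyRegular _ rs M hM (fun r hr => ⟨n, fun y => ?_⟩) i hi x, map_zero]
  obtain ⟨a, rfl⟩ := exists_smul_quotPowOne y
  rw [smul_comm, smul_quotPowOne, smul_zero]
  exact Ideal.pow_mem_pow (mem_ofList hr) n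

lemma subsingleton_of_length_lt [IsNoetherianRing A] {rs : List A}
    (hrs : ∀ n : ℕ, IsWeaklyRegular A (rs.map (· ^ n))) {i : ℕ} (hi : rs.length < i)
    (M : ModuleCat.{0} A) : Subsingleton (ExtColim (quotPow (Ideal.ofList rs)) i M) := by
  refine subsingleton_of_forall_eq 0 fun x => ?_
  obtain ⟨n, x, rfl⟩ := exists_of x
  let K : Ideal A := Ideal.ofList (rs.map (· ^ n)) • ⊤
  have hK : K = Ideal.ofList (rs.map (· ^ n)) := by
    simp [K]
  have : HasProjectiveDimensionLT (ModuleCat.of A (A ⧸ K)) (0 + (rs.map (· ^ n)).length + 1) :=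
    hasProjectiveDimensionLT_of_isWeaklyRegular _ (ModuleCat.of A A) 0 (hrs n)
  have h₁ : K ≤ Ideal.ofList rs ^ n := by
    rw [hK, Ideal.ofList, Ideal.span_le]
    intro a ha
    obtain ⟨r, hr, rfl⟩ := List.mem_map.1 ha
    exact Ideal.pow_mem_pow (mem_ofList hr) n
  obtain ⟨n', h₂⟩ : ∃ n', Ideal.ofList rs ^ n' ≤ K := by
    refine Ideal.exists_pow_le_of_le_radical_of_fg ?_ (IsNoetherian.noetherian _)
    rw [hK, Ideal.ofList, Ideal.span_le]
    intro r hr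
    exact ⟨n, mem_ofList (List.mem_map_of_mem hr)⟩
  have h₃ : Ideal.ofList rs ^ (max n n') ≤ K := (Ideal.pow_le_pow_right (le_max_right n n')).trans h₂
  let g : (quotPow (Ideal.ofList rs)).obj (op (max n n')) ⟶ ModuleCat.of A (A ⧸ K) :=
    quotPowDesc _ (Submodule.Quotient.mk 1 : A ⧸ K) fun a ha => by
      rw [← Submodule.Quotient.mk_smul, smul_eq_mul, mul_one]
      exact (Submodule.Quotient.mk_eq_zero K).2 (h₃ ha)
  let h : ModuleCat.of A (A ⧸ K) ⟶ (quotPow (Ideal.ofList rs)).obj (op n) :=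
    ModuleCat.ofHom (Submodule.factor h₁)
  have hgh : g ≫ h = (quotPow (Ideal.ofList rs)).map (homOfLE (le_max_left n n')).op := by
    ext y
    obtain ⟨a, rfl⟩ := exists_smul_quotPowOne y
    rw [LinearMap.map_smul, LinearMap.map_smul]
    congr 1
    rw [quotPow_map_quotPowOne, ModuleCat.comp_apply, quotPowDesc_quotPowOne]
    rfl
  rw [← of_mk₀_comp (le_max_left n n'), ← hgh, ← Ext.mk₀_comp_mk₀, Ext.comp_assoc_of_second_deg_zero,
    Ext.eq_zero_of_hasProjectiveDimensionLT ((Ext.mk₀ h).comp x (zero_add i)) _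
      (show 0 + (rs.map (· ^ n)).length + 1 ≤ i by simpa using hi), Ext.comp_zero, map_zero]

end ExtColim

lemma isWeaklyRegular_X_pow {k : Type} [Field k] {σ : Type} {s : ℕ} {v : Fin s → σ}
    (hv : Function.Injective v) (n : ℕ) :
    IsWeaklyRegular (MvPolynomial σ k)
      (List.ofFn fun t => (X (v t) ^ n : MvPolynomial σ k)) := by
  classical
  refine ⟨fun i hi => ?_⟩
  have hi' : i < s := by simpa using hi
  have hspan : (Ideal.ofList ((List.ofFn fun t => (X (v t) ^ n : MvPolynomial σ k)).take i) • ⊤ :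
      Ideal (MvPolynomial σ k)) = Ideal.span ((fun d => monomial d (1 : k)) ''
        ((fun t => Finsupp.single (v t) n) '' {t | t.1 < i})) := by
    rw [smul_eq_mul, Ideal.mul_top, Set.image_image, Ideal.ofList]
    congr 1
    ext p
    simp only [Set.mem_ofPred_eq, List.mem_take_iff_getElem, List.getElem_ofFn, Set.mem_image,
      List.length_ofFn, lt_min_iff, ← X_pow_eq_monomial]
    constructor
    · rintro ⟨j, hj, rfl⟩
      exact ⟨⟨j, hj.2⟩, hj.1, rfl⟩
    · rintro ⟨t, ht, rfl⟩
      exact ⟨t.1, ⟨ht, t.2⟩, rfl⟩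
  rw [isSMulRegular_quotient_iff_mem_of_smul_mem, hspan]
  intro p hp
  rw [mem_ideal_span_monomial_image] at hp ⊢
  intro d hd
  rw [List.getElem_ofFn, smul_eq_mul, mul_comm] at hp
  obtain ⟨_, ⟨t, ht, rfl⟩, htd⟩ := hp (d + Finsupp.single (v ⟨i, hi'⟩) n) (by
    rw [mem_support_iff, X_pow_eq_monomial, coeff_mul_monomial, mul_one]
    exact mem_support_iff.1 hd)
  refine ⟨_, ⟨t, ht, rfl⟩, ?_⟩
  have hne : v ⟨i, hi'⟩ ≠ v t := fun h => by
    have := hv h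
    subst this
    exact lt_irrefl i ht
  simp only [Finsupp.single_le_iff, Finsupp.add_apply, Finsupp.single_eq_of_ne' hne, add_zero] at htd ⊢
  exact htd

end Regular

section TorSequence

open MonoidalCategory

variable {A : Type} [CommRing A] {D : ModuleCat.{0} A} (Q : ProjectiveResolution D)

/-- The complex `M ⊗ Q`, as a functor of `M`. -/
noncomputable def tensorComplex : ModuleCat.{0} A ⥤ ChainComplex (ModuleCat.{0} A) ℕ where
  obj M := (((tensoringLeft (ModuleCat.{0} A)).obj M).mapHomologicalComplex _).obj Q.complex
  map f := (NatTrans.mapHomologicalComplex ((tensoringLeft (ModuleCat.{0} A)).map f) _).app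
    Q.complex
  map_id M := by
    rw [CategoryTheory.Functor.map_id, NatTrans.mapHomologicalComplex_id]
    rfl
  map_comp f g := by
    rw [Functor.map_comp, NatTrans.mapHomologicalComplex_comp]
    rfl

instance : (tensorComplex Q).PreservesZeroMorphisms where
  map_zero M N := by
    ext i : 1
    exact MonoidalPreadditive.zero_whiskerRight

/-- `Tor` is the homology of `M ⊗ Q`. -/
noncomputable def torIsoHomology (M : ModuleCat.{0} A) (j : ℕ) :
    ((Tor (ModuleCat.{0} A) j).obj M).obj D ≅ ((tensorComplex Q).obj M).homology j :=
  Q.isoLeftDerivedObj _ j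

instance (i : ℕ) : Module.Flat A (Q.complex.X i) := by
  have : Module.Projective A (Q.complex.X i) :=
    (IsProjective.iff_projective (Q.complex.X i)).2 (Q.projective i)
  infer_instance

lemma tensorComplex_shortExact {S : ShortComplex (ModuleCat.{0} A)} (hS : S.ShortExact) :
    (S.map (tensorComplex Q)).ShortExact :=
  HomologicalComplex.shortExact_of_degreewise_shortExact _ fun i =>
    hS.map_of_exact (tensorRight (Q.complex.X i))

lemma isZero_homology_of_flat (M : ModuleCat.{0} A) [Module.Flat A M] (j : ℕ) :
    Limits.IsZero (((tensorComplex Q).obj M).homology (j + 1)) := by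
  rw [← HomologicalComplex.exactAt_iff_isZero_homology]
  have h := Module.Flat.lTensor_shortComplex_exact M _ (Q.complex_exactAt_succ j)
  exact h

/-- The augmentation of a projective resolution. -/
noncomputable def resolutionAugmentation : Q.complex.X 0 ⟶ D := Q.π.f 0

lemma d_resolutionAugmentation : Q.complex.d 1 0 ≫ resolutionAugmentation Q = 0 :=
  Q.complex_d_comp_π_f_zero

lemma resolutionAugmentation_surjective : Function.Surjective (resolutionAugmentation Q) :=
  (ModuleCat.epi_iff_surjective _).1 (inferInstanceAs (Epi (Q.π.f 0)))

lemma resolutionAugmentation_exact :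
    Function.Exact (Q.complex.d 1 0) (resolutionAugmentation Q) :=
  (ShortComplex.ShortExact.moduleCat_exact_iff_function_exact _).1 Q.exact₀

/-- The augmentation of `M ⊗ Q`. -/
noncomputable def tensorAugmentation (M : ModuleCat.{0} A) :
    ((tensorComplex Q).obj M).X 0 ⟶ M ⊗ D :=
  M ◁ resolutionAugmentation Q

lemma d_tensorAugmentation (M : ModuleCat.{0} A) :
    ((tensorComplex Q).obj M).d 1 0 ≫ tensorAugmentation Q M = 0 := by
  refine (MonoidalCategory.whiskerLeft_comp _ _ _).symm.trans ?_
  rw [d_resolutionAugmentation]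
  exact MonoidalPreadditive.whiskerLeft_zero

lemma tensorAugmentation_surjective (M : ModuleCat.{0} A) :
    Function.Surjective (tensorAugmentation Q M) :=
  LinearMap.lTensor_surjective M (resolutionAugmentation_surjective Q)

lemma tensorAugmentation_exact (M : ModuleCat.{0} A) :
    Function.Exact (((tensorComplex Q).obj M).d 1 0) (tensorAugmentation Q M) :=
  lTensor_exact M (resolutionAugmentation_exact Q) (resolutionAugmentation_surjective Q)

lemma tensorAugmentation_naturality {M N : ModuleCat.{0} A} (f : M ⟶ N) :
    ((tensorComplex Q).map f).f 0 ≫ tensorAugmentation Q N = tensorAugmentation Q M ≫ f ▷ D :=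
  (MonoidalCategory.whisker_exchange _ _).symm

/-- The augmentation of `M ⊗ Q`, on homology. -/
noncomputable def homologyZeroHom (M : ModuleCat.{0} A) :
    ((tensorComplex Q).obj M).homology 0 ⟶ M ⊗ D :=
  ((tensorComplex Q).obj M).homologyι 0 ≫
    ((tensorComplex Q).obj M).descOpcycles (tensorAugmentation Q M) 1 (by simp)
      (d_tensorAugmentation Q M)

lemma homologyZeroHom_naturality {M N : ModuleCat.{0} A} (f : M ⟶ N) :
    HomologicalComplex.homologyMap ((tensorComplex Q).map f) 0 ≫ homologyZeroHom Q N =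
      homologyZeroHom Q M ≫ f ▷ D := by
  rw [homologyZeroHom, HomologicalComplex.homologyι_naturality_assoc, homologyZeroHom,
    Category.assoc]
  congr 1
  rw [← cancel_epi (((tensorComplex Q).obj M).pOpcycles 0),
    HomologicalComplex.p_opcyclesMap_assoc, HomologicalComplex.p_descOpcycles,
    HomologicalComplex.p_descOpcycles_assoc, tensorAugmentation_naturality]

lemma homologyZeroHom_bijective (M : ModuleCat.{0} A) :
    Function.Bijective (homologyZeroHom Q M) := by
  have hp : Function.Surjective (((tensorComplex Q).obj M).pOpcycles 0) :=
    (ModuleCat.epi_iff_surjective _).1 inferInstance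
  have hι : Function.Bijective (((tensorComplex Q).obj M).homologyι 0) :=
    (ConcreteCategory.isIso_iff_bijective _).1 inferInstance
  refine Function.Bijective.comp (g := ((tensorComplex Q).obj M).descOpcycles
    (tensorAugmentation Q M) 1 (by simp) (d_tensorAugmentation Q M)) ⟨?_, ?_⟩ hι
  · refine (injective_iff_map_eq_zero _).2 fun x hx => ?_
    obtain ⟨y, rfl⟩ := hp x
    have hy : tensorAugmentation Q M y = 0 := by
      rw [← hx, ← ModuleCat.comp_apply, HomologicalComplex.p_descOpcycles]
    obtain ⟨z, rfl⟩ := (tensorAugmentation_exact Q M y).1 hy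
    rw [← ModuleCat.comp_apply, HomologicalComplex.d_pOpcycles]
    rfl
  · intro x
    obtain ⟨y, rfl⟩ := tensorAugmentation_surjective Q M x
    refine ⟨((tensorComplex Q).obj M).pOpcycles 0 y, ?_⟩
    rw [← ModuleCat.comp_apply, HomologicalComplex.p_descOpcycles]

variable (D) in
/-- `Tor` in degree zero. -/
noncomputable def torZeroEquiv (M : ModuleCat.{0} A) :
    ((Tor (ModuleCat.{0} A) 0).obj M).obj D ≃ₗ[A] TensorProduct A M D :=
  (torIsoHomology (projectiveResolution D) M 0).toLinearEquiv.trans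
    (LinearEquiv.ofBijective (homologyZeroHom (projectiveResolution D) M).hom
      (homologyZeroHom_bijective (projectiveResolution D) M))

variable (D) in
/-- The shift of `Tor` along a short exact sequence with a flat middle term. -/
noncomputable def torShiftIso {S : ShortComplex (ModuleCat.{0} A)} (hS : S.ShortExact)
    [Module.Flat A S.X₂] (j : ℕ) :
    ((Tor (ModuleCat.{0} A) (j + 2)).obj S.X₃).obj D ≅
      ((Tor (ModuleCat.{0} A) (j + 1)).obj S.X₁).obj D :=
  torIsoHomology (projectiveResolution D) S.X₃ (j + 2) ≪≫
    (tensorComplex_shortExact (projectiveResolution D) hS).δIso (j + 2) (j + 1) (by simp)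
      (isZero_homology_of_flat _ _ _) (isZero_homology_of_flat _ _ _) ≪≫
    (torIsoHomology (projectiveResolution D) S.X₁ (j + 1)).symm

variable (D) in
lemma exists_tor_one {S : ShortComplex (ModuleCat.{0} A)} (hS : S.ShortExact)
    [Module.Flat A S.X₂] :
    ∃ f : ((Tor (ModuleCat.{0} A) 1).obj S.X₃).obj D →ₗ[A] TensorProduct A S.X₁ D,
      Function.Injective f ∧ LinearMap.range f = LinearMap.ker (S.f.hom.rTensor D) := by
  let Q := projectiveResolution D
  have hT := tensorComplex_shortExact Q hS
  have := hT.mono_δ 1 0 (by simp) (isZero_homology_of_flat _ _ _)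
  have hδ : Function.Injective (hT.δ 1 0 (by simp)) := (ModuleCat.mono_iff_injective _).1 this
  refine ⟨((torIsoHomology Q S.X₃ 1).hom ≫ hT.δ 1 0 (by simp) ≫ homologyZeroHom Q S.X₁).hom,
    ?_, ?_⟩
  · exact (homologyZeroHom_bijective Q S.X₁).1.comp
      (hδ.comp (torIsoHomology Q S.X₃ 1).toLinearEquiv.injective)
  have hex := (ShortComplex.ShortExact.moduleCat_exact_iff_function_exact _).1
    (hT.homology_exact₁ 1 0 (by simp))
  have hnat (x : ((tensorComplex Q).obj S.X₁).homology 0) :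
      homologyZeroHom Q S.X₂
        (HomologicalComplex.homologyMap ((tensorComplex Q).map S.f) 0 x) =
        S.f.hom.rTensor D (homologyZeroHom Q S.X₁ x) :=
    ConcreteCategory.congr_hom (homologyZeroHom_naturality Q S.f) x
  ext y
  obtain ⟨x, rfl⟩ := (homologyZeroHom_bijective Q S.X₁).2 y
  rw [LinearMap.mem_ker, ← hnat]
  constructor
  · rintro ⟨z, hz⟩
    have := (homologyZeroHom_bijective Q S.X₁).1 hz
    exact (congr_arg (homologyZeroHom Q S.X₂) ((hex x).2 ⟨_, this⟩)).trans (map_zero _)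
  · intro h
    obtain ⟨z, hz⟩ := (hex x).1 ((homologyZeroHom_bijective Q S.X₂).1 (h.trans (map_zero _).symm))
    obtain ⟨z, rfl⟩ := (torIsoHomology Q S.X₃ 1).toLinearEquiv.surjective z
    exact ⟨z, congr_arg (homologyZeroHom Q S.X₁) hz⟩

end TorSequence

section TopDegree

variable {A : Type} [CommRing A] (X : ℕᵒᵖ ⥤ ModuleCat.{0} A)

namespace ExtColim

/-- The natural map from the tensor product with the value at the ring. -/
noncomputable def pairing (s : ℕ) (M : ModuleCat.{0} A) :
    TensorProduct A M (ExtColim X s (ModuleCat.of A A)) →ₗ[A] ExtColim X s M :=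
  TensorProduct.lift (LinearMap.mk₂ A
    (fun (m : M) x => map X (ModuleCat.ofHom (LinearMap.toSpanSingleton A M m)) s x)
    (fun m m' x => by
      rw [← map_add, ← ModuleCat.ofHom_add, LinearMap.toSpanSingleton_add])
    (fun a m x => by
      rw [← map_smul]
      congr 3
      ext
      simp)
    (fun m x y => _root_.map_add _ _ _)
    (fun a m x => LinearMap.map_smul _ _ _))

@[simp]
lemma pairing_tmul (s : ℕ) (M : ModuleCat.{0} A) (m : M) (x : ExtColim X s (ModuleCat.of A A)) :
    pairing X s M (TensorProduct.tmul A m x) =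
      map X (ModuleCat.ofHom (LinearMap.toSpanSingleton A M m)) s x := rfl

lemma pairing_naturality (s : ℕ) {M N : ModuleCat.{0} A} (f : M ⟶ N)
    (y : TensorProduct A M (ExtColim X s (ModuleCat.of A A))) :
    map X f s (pairing X s M y) = pairing X s N (f.hom.rTensor _ y) := by
  induction y with
  | zero => simp only [_root_.map_zero]
  | add y y' h h' => simp only [_root_.map_add, h, h']
  | tmul m x =>
    rw [LinearMap.rTensor_tmul, pairing_tmul, pairing_tmul, map_map]
    congr 2
    ext
    simp

lemma map_sum {M N : ModuleCat.{0} A} {ι : Type*} (t : Finset ι) (f : ι → (M ⟶ N)) {i : ℕ}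
    (x : ExtColim X i M) : map X (∑ j ∈ t, f j) i x = ∑ j ∈ t, map X (f j) i x := by
  classical
  induction t using Finset.induction_on with
  | empty => simp only [Finset.sum_empty, map, Abelian.Ext.mk₀_zero, comp_zero]
  | insert j t hj ih => rw [Finset.sum_insert hj, Finset.sum_insert hj, map_add, ih]

lemma sum_map_single_map_proj {n i : ℕ} (x : ExtColim X i (ModuleCat.of A (Fin n → A))) :
    ∑ j, map X (ModuleCat.ofHom (LinearMap.toSpanSingleton A (Fin n → A) (Pi.single j 1))) i
      (map X (ModuleCat.ofHom (LinearMap.proj j)) i x) = x := by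
  simp only [map_map]
  rw [← map_sum]
  convert! map_id x
  ext m j
  simp [ModuleCat.hom_sum, Finset.sum_apply, Pi.single_apply, ite_apply]

lemma pairing_bijective_of_free (s n : ℕ) :
    Function.Bijective (pairing X s (ModuleCat.of A (Fin n → A))) := by
  refine Function.bijective_iff_has_inverse.2 ⟨fun x => ∑ j, TensorProduct.tmul A (Pi.single j 1)
    (map X (ModuleCat.ofHom (LinearMap.proj j)) s x), fun y => ?_, fun x => ?_⟩
  · induction y with
    | zero => simp only [_root_.map_zero, TensorProduct.tmul_zero, Finset.sum_const_zero]
    | add y y' h h' =>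
      simp only [_root_.map_add, TensorProduct.tmul_add, Finset.sum_add_distrib, h, h']
    | tmul m x =>
      have (j : Fin n) : map X (ModuleCat.ofHom (LinearMap.proj j)) s
          (map X (ModuleCat.ofHom (LinearMap.toSpanSingleton A (Fin n → A) m)) s x) =
          m j • x := by
        rw [map_map, ← map_id (X := X) (m j • x), LinearMap.map_smul, ← map_smul]
        congr 2
        ext
        simp
      refine (Finset.sum_congr rfl fun j _ => congr_arg _ (this j)).trans ?_
      simp only [TensorProduct.tmul_smul, TensorProduct.smul_tmul', ← TensorProduct.sum_tmul]
      congr 1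
      ext j
      simp [Finset.sum_apply, Pi.single_apply]
  · rw [_root_.map_sum]
    exact sum_map_single_map_proj X x

lemma subsingleton_of_free {i : ℕ} [Subsingleton (ExtColim X i (ModuleCat.of A A))] (n : ℕ) :
    Subsingleton (ExtColim X i (ModuleCat.of A (Fin n → A))) :=
  subsingleton_of_forall_eq 0 fun x => by
    rw [← sum_map_single_map_proj X x]
    exact Finset.sum_eq_zero fun j _ => by
      rw [Subsingleton.elim (map X (ModuleCat.ofHom (LinearMap.proj j)) i x) 0, _root_.map_zero]

variable {X} {s : ℕ}

lemma exists_presentation [IsNoetherianRing A] (M : ModuleCat.{0} A) [Module.Finite A M] :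
    ∃ (n : ℕ) (K : ModuleCat.{0} A) (_ : Module.Finite A K)
      (f : K ⟶ ModuleCat.of A (Fin n → A)) (g : ModuleCat.of A (Fin n → A) ⟶ M)
      (h : f ≫ g = 0), (ShortComplex.mk f g h).ShortExact := by
  obtain ⟨n, p, hp⟩ := Module.Finite.exists_fin' A M
  refine ⟨n, ModuleCat.of A (LinearMap.ker p), inferInstance, ModuleCat.ofHom (Submodule.subtype _),
    ModuleCat.ofHom p, by ext x; exact x.2, ?_⟩
  refine ModuleCat.shortComplex_shortExact _ ?_ (Submodule.subtype_injective _) hp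
  exact LinearMap.exact_subtype_ker_map p

lemma pairing_surjective [IsNoetherianRing A]
    (h : ∀ (M : ModuleCat.{0} A), Subsingleton (ExtColim X (s + 1) M))
    (M : ModuleCat.{0} A) [Module.Finite A M] : Function.Surjective (pairing X s M) := by
  obtain ⟨n, K, _, f, g, w, hS⟩ := exists_presentation M
  intro x
  obtain ⟨y, rfl⟩ := (exact_map_δ (X := X) hS s x).1 (Subsingleton.elim _ _)
  obtain ⟨z, rfl⟩ := (pairing_bijective_of_free X s n).2 y
  exact ⟨g.hom.rTensor _ z, (pairing_naturality X s g z).symm⟩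

lemma pairing_bijective [IsNoetherianRing A]
    (h : ∀ (M : ModuleCat.{0} A), Subsingleton (ExtColim X (s + 1) M))
    (M : ModuleCat.{0} A) [Module.Finite A M] : Function.Bijective (pairing X s M) := by
  refine ⟨(injective_iff_map_eq_zero _).2 fun y hy => ?_, pairing_surjective h M⟩
  obtain ⟨n, K, _, f, g, w, hS⟩ := exists_presentation M
  have hg : Function.Surjective g.hom := hS.moduleCat_surjective_g
  have hex : Function.Exact f.hom g.hom :=
    (ShortComplex.ShortExact.moduleCat_exact_iff_function_exact _).1 hS.exact
  obtain ⟨z, rfl⟩ := LinearMap.rTensor_surjective _ hg y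
  rw [← pairing_naturality] at hy
  obtain ⟨u, hu⟩ := (exact_map (X := X) hS s _).1 hy
  obtain ⟨v, rfl⟩ := pairing_surjective h K u
  have : f.hom.rTensor _ v = z := (pairing_bijective_of_free X s n).1
    ((pairing_naturality X s f v).symm.trans hu)
  exact (rTensor_exact _ hex hg z).2 ⟨v, this⟩

lemma nonempty_equiv_tor [IsNoetherianRing A]
    (h : ∀ (M : ModuleCat.{0} A), Subsingleton (ExtColim X (s + 1) M))
    (h' : ∀ i < s, Subsingleton (ExtColim X i (ModuleCat.of A A))) (j : ℕ) :
    ∀ (i : ℕ) (_ : i + j = s) (M : ModuleCat.{0} A) [Module.Finite A M],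
    Nonempty (ExtColim X i M ≃ₗ[A]
      ((Tor (ModuleCat.{0} A) j).obj M).obj
        (ModuleCat.of A (ExtColim X s (ModuleCat.of A A)))) := by
  induction j with
  | zero =>
    rintro i rfl M _
    exact ⟨(LinearEquiv.ofBijective _ (pairing_bijective h M)).symm.trans
      (torZeroEquiv (ModuleCat.of A (ExtColim X i (ModuleCat.of A A))) M).symm⟩
  | succ j ih =>
    rintro i rfl M _
    obtain ⟨n, K, _, f, g, w, hS⟩ := exists_presentation M
    have := h' i (by omega)
    have hF := subsingleton_of_free X (i := i) n
    have : Module.Flat A (ModuleCat.of A (Fin n → A)) :=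
      inferInstanceAs (Module.Flat A (Fin n → A))
    cases j with
    | zero =>
      obtain ⟨φ, hφ, hr⟩ := exists_tor_one
        (ModuleCat.of A (ExtColim X (i + 1) (ModuleCat.of A A))) hS
      let e := LinearEquiv.ofBijective _ (pairing_bijective h K)
      let ψ := e.symm.toLinearMap ∘ₗ δ X hS i
      have hδ : Function.Injective (δ X hS i) := by
        refine (injective_iff_map_eq_zero _).2 fun x hx => ?_
        obtain ⟨y, rfl⟩ := (exact_map_δ hS i x).1 hx
        rw [Subsingleton.elim (α := ExtColim X i (ModuleCat.of A (Fin n → A))) y 0,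
          _root_.map_zero]
      have hψ : Function.Injective ψ := e.symm.injective.comp hδ
      have hr' : LinearMap.range ψ = LinearMap.range φ := by
        rw [hr]
        ext y
        rw [LinearMap.mem_ker, ← (pairing_bijective_of_free X (i + 1) n).1.eq_iff,
          _root_.map_zero]
        refine Iff.trans ?_ (Eq.congr_left (pairing_naturality X (i + 1) f y))
        refine Iff.trans ?_ (exact_δ_map hS i (e y)).symm
        exact ⟨fun ⟨x, hx⟩ => ⟨x, (e.symm_apply_eq.1 hx)⟩,
          fun ⟨x, hx⟩ => ⟨x, e.symm_apply_eq.2 hx⟩⟩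
      exact ⟨(LinearEquiv.ofInjective ψ hψ).trans ((LinearEquiv.ofEq _ _ hr').trans
        (LinearEquiv.ofInjective φ hφ).symm)⟩
    | succ j =>
      have := h' (i + 1) (by omega)
      have hF' := subsingleton_of_free X (i := i + 1) n
      obtain ⟨e⟩ := ih (i + 1) (by omega) K
      exact ⟨(LinearEquiv.ofBijective _ (δ_bijective X hS i)).trans (e.trans
        (torShiftIso (ModuleCat.of A (ExtColim X _ (ModuleCat.of A A))) hS j).symm.toLinearEquiv)⟩

end ExtColim

end TopDegree

section Variables

variable (k : Type) [Field k] (m s : ℕ)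

/-- The `z`-variables. -/
noncomputable def zVars : List (MvPolynomial (Fin m ⊕ Fin s) k) :=
  List.ofFn fun t => X (Sum.inr t)

lemma length_zVars : (zVars k m s).length = s := by simp [zVars]

lemma span_range_X_eq : Ideal.span
    (Set.range fun t : Fin s => (X (Sum.inr t) : MvPolynomial (Fin m ⊕ Fin s) k)) =
      Ideal.ofList (zVars k m s) := by
  refine congr_arg Ideal.span (Set.ext fun x => ?_)
  simp [zVars, List.mem_ofFn]

lemma isWeaklyRegular_zVars_pow (n : ℕ) : RingTheory.Sequence.IsWeaklyRegular
    (MvPolynomial (Fin m ⊕ Fin s) k) ((zVars k m s).map (· ^ n)) := by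
  rw [zVars, List.map_ofFn]
  exact isWeaklyRegular_X_pow Sum.inr_injective n

lemma isWeaklyRegular_zVars : RingTheory.Sequence.IsWeaklyRegular
    (MvPolynomial (Fin m ⊕ Fin s) k) (zVars k m s) := by
  simpa using isWeaklyRegular_zVars_pow k m s 1

lemma subsingleton_extColim_zVars_of_lt {i : ℕ} (hi : s < i)
    (M : ModuleCat.{0} (MvPolynomial (Fin m ⊕ Fin s) k)) :
    Subsingleton (ExtColim (quotPow (Ideal.ofList (zVars k m s))) i M) :=
  ExtColim.subsingleton_of_length_lt (isWeaklyRegular_zVars_pow k m s)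
    ((length_zVars k m s).trans_lt hi) M

/-- The inverse polynomials as a colimit of `Ext`-modules. -/
noncomputable def invPolyModuleEquiv :
    ExtColim (quotPow (Ideal.ofList (zVars k m s))) s
      (ModuleCat.of _ (MvPolynomial (Fin m ⊕ Fin s) k)) ≃ₗ[MvPolynomial (Fin m ⊕ Fin s) k]
      invPolyModule k m s :=
  (ExtColim.equivLocalCohomology _ s _).trans
    (eqToIso (by rw [invPolyModule, span_range_X_eq])).toLinearEquiv

variable (R : Type) [CommRing R] [Algebra k R] (w : MvPolynomial (Fin m ⊕ Fin s) k →ₐ[k] R)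

lemma map_ofList_zVars : (Ideal.ofList (zVars k m s)).map w.toRingHom =
    Ideal.span (Set.range fun t : Fin s => w (X (Sum.inr t))) := by
  rw [← span_range_X_eq, Ideal.map_span, ← Set.range_comp]
  rfl

lemma finite_rAsPModule (hw : Function.Surjective w) :
    Module.Finite (MvPolynomial (Fin m ⊕ Fin s) k) (rAsPModule k m s R w) := by
  let _ : Module (MvPolynomial (Fin m ⊕ Fin s) k) R := Module.compHom R w.toRingHom
  let f : MvPolynomial (Fin m ⊕ Fin s) k →ₗ[MvPolynomial (Fin m ⊕ Fin s) k] R :=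
    { toFun := w
      map_add' := map_add w
      map_smul' := map_mul w }
  exact Module.Finite.of_surjective f hw

lemma exists_addEquiv_locCohR (hw : Function.Surjective w) (i : ℕ) :
    ∃ e : locCohR k m s R w i ≃+
      ExtColim (quotPow (Ideal.ofList (zVars k m s))) i (rAsPModule k m s R w),
      ∀ (p : MvPolynomial (Fin m ⊕ Fin s) k) (x : locCohR k m s R w i),
        e (w p • x) = p • e x := by
  have h := exists_addEquiv_extColim (f := w.toRingHom) hw
    (Ideal.ofList (zVars k m s)) i (ModuleCat.of R R)
  rw [map_ofList_zVars] at h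
  obtain ⟨e, he⟩ := h
  let e' : locCohR k m s R w i ≃ₗ[R] _ :=
    (ExtColim.equivLocalCohomology _ i (ModuleCat.of R R)).symm
  exact ⟨e'.toAddEquiv.trans e, fun p x => (congr_arg e (e'.map_smul (w p) x)).trans (he p _)⟩

end Variables

section Stmt8

variable (k : Type) [Field k] (m s : ℕ) (R : Type) [CommRing R] [Algebra k R]
  (w : MvPolynomial (Fin m ⊕ Fin s) k →ₐ[k] R)

/-- Let `k` be a field, `P = k[y_1,…,y_m,z_1,…,z_s]`, `w : P → R` a surjective
`k`-algebra homomorphism, `𝔠 ⊆ R` the ideal generated by the `w(z_t)`, and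
`D = H^s_{(z_1,…,z_s)}(P)`.  Then for every `i` there is an isomorphism of `k`-vector spaces
`H^i_𝔠(R) ≅ Tor^P_{s−i}(R, D)` (with `Tor_j = 0` for `j < 0`, i.e. `H^i_𝔠(R) = 0` for
`i > s`). -/
theorem localCohomology_iso_tor (hw : Function.Surjective w) :
    (∀ i : ℕ, i ≤ s →
      Nonempty
        (letI : Module k (locCohR k m s R w i) := Module.compHom _ (algebraMap k R)
         letI : Module k (torRD k m s R w (s - i)) :=
           Module.compHom _ (algebraMap k (MvPolynomial (Fin m ⊕ Fin s) k))
         (locCohR k m s R w i) ≃ₗ[k] (torRD k m s R w (s - i)))) ∧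
    (∀ i : ℕ, s < i → Subsingleton (locCohR k m s R w i)) := by
  have hvan (i : ℕ) (hi : s < i) := subsingleton_extColim_zVars_of_lt k m s hi
  constructor
  · intro i hi
    obtain ⟨e, he⟩ := exists_addEquiv_locCohR k m s R w hw i
    have := finite_rAsPModule k m s R w hw
    obtain ⟨e'⟩ := ExtColim.nonempty_equiv_tor (hvan (s + 1) (by omega))
      (fun i hi => ExtColim.subsingleton_of_lt_length (isWeaklyRegular_zVars k m s)
        (hi.trans_eq (length_zVars k m s).symm)) (s - i) i (by omega) (rAsPModule k m s R w)
    let e'' := e'.trans (((Tor _ (s - i)).obj (rAsPModule k m s R w)).mapIso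
      (invPolyModuleEquiv k m s).toModuleIso).toLinearEquiv
    let _ : Module k (locCohR k m s R w i) := Module.compHom _ (algebraMap k R)
    let _ : Module k (torRD k m s R w (s - i)) :=
      Module.compHom _ (algebraMap k (MvPolynomial (Fin m ⊕ Fin s) k))
    exact ⟨{ (e.trans e''.toAddEquiv : locCohR k m s R w i ≃+ torRD k m s R w (s - i)) with
      map_smul' := fun c x => by
        change e'' (e (algebraMap k R c • x)) =
          algebraMap k (MvPolynomial (Fin m ⊕ Fin s) k) c • e'' (e x)
        rw [← w.commutes c, he, map_smul] }⟩
  · intro i hi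
    obtain ⟨e, -⟩ := exists_addEquiv_locCohR k m s R w hw i
    have := hvan i hi (rAsPModule k m s R w)
    exact e.toEquiv.subsingleton

end Stmt8
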